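/- Let C be a knot-like complex. If there does not exist a local map from R (the trivial knot-like complex with zero differential) to C, then there exists a local map from C to R. -/

import Mathlib

/-!
Common setup: the ring `R = 𝔽₂[U,V]/(UV = 0)`, bigraded free finitely generated chain
complexes over `R` ("pre-complexes"), knot-like complexes, local maps and local
equivalence, standard and semistandard complexes, short maps, the `Z^!` order,
the invariants `a_i`, `φ_j`, `P`, shift maps, tensor products, duals, and direct sums.
-/

set_option synthInstance.maxHeartbeats 1000000
set_option maxHeartbeats 1000000

noncomputable section

/-- The polynomial ring `𝔽₂[U,V]`. -/
abbrev PolyUV : Type := MvPolynomial (Fin 2) (ZMod 2)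

/-- The ideal `(U·V)`. -/
def IUV : Ideal PolyUV := Ideal.span {(MvPolynomial.X 0 * MvPolynomial.X 1 : PolyUV)}

/-- The ring `R = 𝔽₂[U,V]/(UV = 0)`. -/
abbrev RUV : Type := PolyUV ⧸ IUV

instance : CommRing RUV := Ideal.Quotient.commRing IUV

/-- The image of `U` in `R`. -/
def Uv : RUV := Ideal.Quotient.mk IUV (MvPolynomial.X 0)

/-- The image of `V` in `R`. -/
def Vv : RUV := Ideal.Quotient.mk IUV (MvPolynomial.X 1)

/-- `r ∈ R` is homogeneous of bidegree `(p, q)` for the bigrading with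
`gr(U) = (-2, 0)`, `gr(V) = (0, -2)`, `gr(1) = (0, 0)` (coefficients in `𝔽₂`). -/
def IsHomog (r : RUV) (p q : ℤ) : Prop :=
  r = 0 ∨ (∃ a : ℕ, r = Uv ^ a ∧ p = -(2 * (a : ℤ)) ∧ q = 0) ∨
    (∃ b : ℕ, r = Vv ^ b ∧ p = 0 ∧ q = -(2 * (b : ℤ)))

/-- A finitely generated free bigraded module over `R` with a distinguished basis
indexed by `Fin n`, together with a bigrading `gr` on the basis and a matrix `dm`
recording a prospective differential: `dm i j` is the coefficient of the `j`-th basis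
vector in the differential of the `i`-th basis vector. -/
structure PreCx where
  n : ℕ
  gr : Fin n → ℤ × ℤ
  dm : Fin n → Fin n → RUV

/-- The underlying free `R`-module of a pre-complex. -/
abbrev Msub (C : PreCx) : Type := Fin C.n →₀ RUV

/-- The differential of a pre-complex, as an `R`-linear map. -/
def dmap (C : PreCx) : Msub C →ₗ[RUV] Msub C :=
  Finsupp.linearCombination RUV fun i => ∑ j, Finsupp.single j (C.dm i j)

/-- The submodule `U·C ⊆ C`; `C/U` is the quotient by this submodule. -/
def uSub (C : PreCx) : Submodule RUV (Msub C) :=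
  LinearMap.range (LinearMap.lsmul RUV (Msub C) Uv)

/-- The submodule `V·C ⊆ C`; `C/V` is the quotient by this submodule. -/
def vSub (C : PreCx) : Submodule RUV (Msub C) :=
  LinearMap.range (LinearMap.lsmul RUV (Msub C) Vv)

/-- Chains which die in the homology of `C/U`: the preimage in `C` of the boundaries of
the induced differential on `C/U`. -/
def bdryU (C : PreCx) : Submodule RUV (Msub C) := uSub C ⊔ LinearMap.range (dmap C)

/-- Chains which die in the homology of `C/V`. -/
def bdryV (C : PreCx) : Submodule RUV (Msub C) := vSub C ⊔ LinearMap.range (dmap C)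

/-- A chain `x ∈ C` is homogeneous of bidegree `(p, q)`. -/
def ChainHomog (C : PreCx) (x : Msub C) (p q : ℤ) : Prop :=
  ∀ j, IsHomog (x j) (p - (C.gr j).1) (q - (C.gr j).2)

/-- `x` is a `V`-tower class generator: its class in `H_*(C/U)` is a `V`-nontorsion cycle
whose image generates `H_*(C/U)/(V-torsion)` (equivalently, it is maximally `V`-graded
among `V`-nontorsion classes). -/
def IsVTowerGen (C : PreCx) (x : Msub C) : Prop :=
  dmap C x ∈ uSub C ∧ (∀ k : ℕ, Vv ^ k • x ∉ bdryU C) ∧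
    ∀ z : Msub C, dmap C z ∈ uSub C →
      ∃ (r : RUV) (k : ℕ), Vv ^ k • (z - r • x) ∈ bdryU C

/-- `x` is a `U`-tower class generator: its class in `H_*(C/V)` is a `U`-nontorsion cycle
whose image generates `H_*(C/V)/(U-torsion)`. -/
def IsUTowerGen (C : PreCx) (x : Msub C) : Prop :=
  dmap C x ∈ vSub C ∧ (∀ k : ℕ, Uv ^ k • x ∉ bdryV C) ∧
    ∀ z : Msub C, dmap C z ∈ vSub C →
      ∃ (r : RUV) (k : ℕ), Uv ^ k • (z - r • x) ∈ bdryV C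

/-- `C` is a chain complex over `R` whose differential has degree `(-1, -1)`. -/
def IsCplx (C : PreCx) : Prop :=
  (∀ x, dmap C (dmap C x) = 0) ∧
    ∀ i j, IsHomog (C.dm i j) ((C.gr i).1 - 1 - (C.gr j).1) ((C.gr i).2 - 1 - (C.gr j).2)

/-- A knot-like complex: a free, finitely generated, bigraded chain complex over `R`
whose differential has degree `(-1,-1)`, such that `H_*(C/U)/(V`-torsion`) ≅ 𝔽₂[V]` with
all `V`-nontorsion elements of `H_*(C/U)` in `U`-grading `0`, and
`H_*(C/V)/(U`-torsion`) ≅ 𝔽₂[U]` with all `U`-nontorsion elements of `H_*(C/V)` in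
`V`-grading `0`. -/
structure IsKnotLike (C : PreCx) : Prop where
  dsq : ∀ x, dmap C (dmap C x) = 0
  dhomog : ∀ i j, IsHomog (C.dm i j)
    ((C.gr i).1 - 1 - (C.gr j).1) ((C.gr i).2 - 1 - (C.gr j).2)
  vTowerExists : ∃ x, IsVTowerGen C x
  vTowerGr : ∀ x p q, ChainHomog C x p q → dmap C x ∈ uSub C →
    (∀ k : ℕ, Vv ^ k • x ∉ bdryU C) → p = 0
  uTowerExists : ∃ x, IsUTowerGen C x
  uTowerGr : ∀ x p q, ChainHomog C x p q → dmap C x ∈ vSub C →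
    (∀ k : ℕ, Uv ^ k • x ∉ bdryV C) → q = 0

/-- A module map `f : C₁ → C₂` is homogeneous of bidegree `(s, t)`. -/
def MapHomogShift (C₁ C₂ : PreCx) (f : Msub C₁ →ₗ[RUV] Msub C₂) (s t : ℤ) : Prop :=
  ∀ i j, IsHomog (f (Finsupp.single i 1) j)
    ((C₁.gr i).1 + s - (C₂.gr j).1) ((C₁.gr i).2 + t - (C₂.gr j).2)

/-- A local map `f : C₁ → C₂`: an absolutely `U`-graded, relatively `V`-graded,
`R`-equivariant chain map inducing an isomorphism on `H_*(·/U)/(V-torsion)`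
(equivalently, taking `V`-tower generators to `V`-tower generators). -/
structure IsLocalMap (C₁ C₂ : PreCx) (f : Msub C₁ →ₗ[RUV] Msub C₂) : Prop where
  chain : ∀ x, f (dmap C₁ x) = dmap C₂ (f x)
  graded : ∃ s : ℤ, MapHomogShift C₁ C₂ f 0 s
  towers : ∀ x, IsVTowerGen C₁ x → IsVTowerGen C₂ (f x)

/-- `C₁ ≤ C₂`: there exists a local map `C₁ → C₂`. -/
def LocalLE (C₁ C₂ : PreCx) : Prop := ∃ f, IsLocalMap C₁ C₂ f

/-- Local equivalence of complexes: local maps in both directions. -/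
def LocalEquiv (C₁ C₂ : PreCx) : Prop := LocalLE C₁ C₂ ∧ LocalLE C₂ C₁

/-- `C` is reduced: `∂ ≡ 0 mod (U, V)`. -/
def Reduced (C : PreCx) : Prop := ∀ i j, C.dm i j ∈ Ideal.span ({Uv, Vv} : Set RUV)

/-! ### Standard complexes -/

/-- The shift in bigrading from `x_k` to `x_{k+1}` in a standard complex, where the
parameter joining them is `b` (`k` is the 0-based index of the parameter, so the
parameter is a `U`-power arrow if `k` is even and a `V`-power arrow if `k` is odd). -/
def stepShift (k : ℕ) (b : ℤ) : ℤ × ℤ :=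
  if k % 2 = 0 then
    if b < 0 then (2 * (b.natAbs : ℤ) - 1, -1) else (1 - 2 * (b.natAbs : ℤ), 1)
  else
    if b < 0 then (-1, 2 * (b.natAbs : ℤ) - 1) else (1, 1 - 2 * (b.natAbs : ℤ))

/-- Bigrading of `x_i` relative to `x_0` in the standard complex with parameters `L`. -/
def grRel (L : List ℤ) (i : ℕ) : ℤ × ℤ :=
  ∑ k ∈ Finset.range i, stepShift k (L.getD k 0)

/-- The bigrading of the standard complex of parameters `L`, normalized so that
`gr_U(x_0) = 0` and `gr_V(x_n) = 0`. -/
def stdGr (L : List ℤ) (i : Fin (L.length + 1)) : ℤ × ℤ :=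
  ((grRel L (i : ℕ)).1, (grRel L (i : ℕ)).2 - (grRel L L.length).2)

/-- The differential matrix of the standard complex of parameters `L = (b_1, …, b_n)`:
for `i` odd (1-based), `∂_U x_{i-1} = U^{|b_i|} x_i` if `b_i < 0` and
`∂_U x_i = U^{b_i} x_{i-1}` if `b_i > 0`; for `i` even the same with `V` in place of `U`;
all other differentials vanish. -/
def stdDm (L : List ℤ) (i j : Fin (L.length + 1)) : RUV :=
  if (j : ℕ) = (i : ℕ) + 1 ∧ L.getD (i : ℕ) 0 < 0 then
    (if (i : ℕ) % 2 = 0 then Uv else Vv) ^ (L.getD (i : ℕ) 0).natAbs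
  else if (i : ℕ) = (j : ℕ) + 1 ∧ 0 < L.getD (j : ℕ) 0 then
    (if (j : ℕ) % 2 = 0 then Uv else Vv) ^ (L.getD (j : ℕ) 0).natAbs
  else 0

/-- The standard complex `C(b_1, …, b_n)` of a list of parameters `L = (b_1, …, b_n)`,
with generators `x_0, …, x_n`.  (For `L = []` this is the trivial complex `R`.) -/
def StdCx (L : List ℤ) : PreCx := ⟨L.length + 1, stdGr L, stdDm L⟩

/-- `L` is a valid parameter sequence for a standard complex: all entries are nonzero
and the length is even (possibly zero). -/
def IsStdSeq (L : List ℤ) : Prop := (∀ b ∈ L, b ≠ 0) ∧ Even L.length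

/-- The trivial standard complex `C(0) = R`. -/
def trivCx : PreCx := StdCx []

/-- The bigrading of the semistandard complex `C'(b_1, …, b_n)` (`n` odd), inherited from
the ambient standard complex `C(b_1, …, b_n, 1)`. -/
def semiGr (L : List ℤ) (i : Fin (L.length + 1)) : ℤ × ℤ :=
  ((grRel L (i : ℕ)).1, (grRel L (i : ℕ)).2 - (grRel L L.length).2 + 1)

/-- The semistandard complex `C'(b_1, …, b_n)` (`n` odd): the subcomplex of
`C(b_1, …, b_n, 1)` generated by `x_0, …, x_n`. -/
def SemiStdCx (L : List ℤ) : PreCx := ⟨L.length + 1, semiGr L, stdDm L⟩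

/-! ### Tensor products, duals, direct sums -/

/-- The tensor product (over `R`) of two pre-complexes, with basis `x_i ⊗ y_j` and
differential `∂(x ⊗ y) = ∂x ⊗ y + x ⊗ ∂y` (signs are irrelevant in characteristic 2). -/
def tensorCx (C₁ C₂ : PreCx) : PreCx where
  n := C₁.n * C₂.n
  gr := fun p => C₁.gr (finProdFinEquiv.symm p).1 + C₂.gr (finProdFinEquiv.symm p).2
  dm := fun p q =>
    (if (finProdFinEquiv.symm p).2 = (finProdFinEquiv.symm q).2 then
      C₁.dm (finProdFinEquiv.symm p).1 (finProdFinEquiv.symm q).1 else 0) +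
    (if (finProdFinEquiv.symm p).1 = (finProdFinEquiv.symm q).1 then
      C₂.dm (finProdFinEquiv.symm p).2 (finProdFinEquiv.symm q).2 else 0)

/-- The dual complex `C^∨ = Hom_R(C, R)`, described on the dual basis: the gradings are
negated and the differential matrix is transposed. -/
def dualCx (C : PreCx) : PreCx := ⟨C.n, fun i => -C.gr i, fun i j => C.dm j i⟩

/-- The direct sum of two pre-complexes. -/
def sumCx (C₁ C₂ : PreCx) : PreCx where
  n := C₁.n + C₂.n
  gr := fun p => Sum.elim C₁.gr C₂.gr (finSumFinEquiv.symm p)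
  dm := fun p q =>
    match finSumFinEquiv.symm p, finSumFinEquiv.symm q with
    | Sum.inl i, Sum.inl k => C₁.dm i k
    | Sum.inr j, Sum.inr l => C₂.dm j l
    | _, _ => 0

/-- A homotopy equivalence of bigraded chain complexes over `R`: chain maps `f, g`
preserving the bigrading, with `g ∘ f ≃ id` and `f ∘ g ≃ id` via `R`-equivariant
homotopies of bidegree `(1, 1)`. -/
def HomotopyEquivCx (C₁ C₂ : PreCx) : Prop :=
  ∃ (f : Msub C₁ →ₗ[RUV] Msub C₂) (g : Msub C₂ →ₗ[RUV] Msub C₁)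
    (H : Msub C₁ →ₗ[RUV] Msub C₁) (K : Msub C₂ →ₗ[RUV] Msub C₂),
    (∀ x, f (dmap C₁ x) = dmap C₂ (f x)) ∧
    (∀ y, g (dmap C₂ y) = dmap C₁ (g y)) ∧
    MapHomogShift C₁ C₂ f 0 0 ∧ MapHomogShift C₂ C₁ g 0 0 ∧
    MapHomogShift C₁ C₁ H 1 1 ∧ MapHomogShift C₂ C₂ K 1 1 ∧
    (∀ x, g (f x) - x = dmap C₁ (H x) + H (dmap C₁ x)) ∧
    (∀ y, f (g y) - y = dmap C₂ (K y) + K (dmap C₂ y))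

/-- An isomorphism of bigraded chain complexes over `R`. -/
def IsBigradedChainIso (C₁ C₂ : PreCx) (f : Msub C₁ →ₗ[RUV] Msub C₂) : Prop :=
  Function.Bijective f ∧ (∀ x, f (dmap C₁ x) = dmap C₂ (f x)) ∧ MapHomogShift C₁ C₂ f 0 0

/-! ### Short maps -/

/-- A short map `f : C(b_1, …, b_n) ⇝ C`: an absolutely `U`-graded, relatively
`V`-graded `R`-module map which is a chain map at `x_1, …, x_{n-1}` and commutes with
the `V`-part of the differential at `x_n` (for reduced `C`, the failure
`∂ f(x_n) - f(∂_V x_n)` is exactly `∂_U f(x_n) ∈ U·C`). -/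
def IsShortMap (L : List ℤ) (C : PreCx) (f : Msub (StdCx L) →ₗ[RUV] Msub C) : Prop :=
  (∃ s : ℤ, MapHomogShift (StdCx L) C f 0 s) ∧
  (∀ i : Fin (L.length + 1), 1 ≤ (i : ℕ) → (i : ℕ) + 1 ≤ L.length →
    f (dmap (StdCx L) (Finsupp.single i 1)) = dmap C (f (Finsupp.single i 1))) ∧
  dmap C (f (Finsupp.single (Fin.last L.length) 1)) -
    f (dmap (StdCx L) (Finsupp.single (Fin.last L.length) 1)) ∈ uSub C

/-- A short local map: a short map sending the `V`-tower generator `x_0` to a `V`-tower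
generator (hence inducing an isomorphism on `H_*(·/U)/(V-torsion)`). -/
def IsShortLocalMap (L : List ℤ) (C : PreCx) (f : Msub (StdCx L) →ₗ[RUV] Msub C) : Prop :=
  IsShortMap L C f ∧ IsVTowerGen C (f (Finsupp.single (0 : Fin (L.length + 1)) 1))

/-- A local map from the semistandard complex `C'(b_1, …, b_n)` to a knot-like complex:
a grading-preserving `R`-equivariant chain map under which the class of `x_0`
generates `H_*(C/U)/(V-torsion)`. -/
def IsSemiLocalMap (L : List ℤ) (C : PreCx) (f : Msub (SemiStdCx L) →ₗ[RUV] Msub C) : Prop :=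
  (∀ x, f (dmap (SemiStdCx L) x) = dmap C (f x)) ∧
  MapHomogShift (SemiStdCx L) C f 0 0 ∧
  IsVTowerGen C (f (Finsupp.single (0 : Fin (L.length + 1)) 1))

/-! ### The order `Z^!` and the numerical invariants -/

/-- The embedding of `Z^!` into `ℚ` realizing the order
`-1 <^! -2 <^! ⋯ <^! 0 <^! ⋯ <^! 2 <^! 1`: send `0 ↦ 0` and `a ↦ 1/a` otherwise. -/
def qval (a : ℤ) : ℚ := if a = 0 then 0 else 1 / (a : ℚ)

/-- The order `≤^!` on `Z^!`. -/
def bangLE (a b : ℤ) : Prop := qval a ≤ qval b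

/-- Pad a finite sequence with trailing zeros. -/
def seqPad (L : List ℤ) (i : ℕ) : ℤ := L.getD i 0

/-- The lexicographic order on finite integer sequences induced by `≤^!`, padding the
shorter sequence with trailing zeros. -/
def bangLexLE (L₁ L₂ : List ℤ) : Prop :=
  (∀ i, seqPad L₁ i = seqPad L₂ i) ∨
    ∃ k, (∀ i < k, seqPad L₁ i = seqPad L₂ i) ∧ qval (seqPad L₁ k) < qval (seqPad L₂ k)

/-- `m` is an upper bound for `S ⊆ Z^!` with respect to `≤^!`. -/
def IsBangUB (S : Set ℤ) (m : ℤ) : Prop := ∀ b ∈ S, qval b ≤ qval m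

/-- `m = sup^! S`, the least upper bound of `S ⊆ Z^!` with respect to `≤^!`. -/
def IsBangLUB (S : Set ℤ) (m : ℤ) : Prop :=
  IsBangUB S m ∧ ∀ m' : ℤ, IsBangUB S m' → qval m ≤ qval m'

/-- Candidate set for the next invariant: given the already-constructed prefix `P`,
those nonzero `b` such that some standard complex `C(P, b, rest) ≤ C`. -/
def candSet (C : PreCx) (P : List ℤ) : Set ℤ :=
  {b | b ≠ 0 ∧ ∃ rest : List ℤ, IsStdSeq (P ++ b :: rest) ∧ LocalLE (StdCx (P ++ b :: rest)) C}

/-- `a` is the sequence of numerical invariants `a_i(C)` (indexed from `0`):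
once a term vanishes all later terms vanish, and otherwise each term is
`sup^!` of the corresponding candidate set. -/
def InvSeq (C : PreCx) (a : ℕ → ℤ) : Prop :=
  ∀ k : ℕ,
    ((∃ i < k, a i = 0) → a k = 0) ∧
    ((∀ i < k, a i ≠ 0) → IsBangLUB (candSet C ((List.range k).map a)) (a k))

/-- The first `n` terms of `a`, with the (all-zero) tail deleted. -/
def truncSeq (a : ℕ → ℤ) (n : ℕ) : List ℤ :=
  ((List.range n).map a).takeWhile (fun b => b != 0)

/-! ### The homomorphisms `φ_j`, `P` and the shifts `sh_m` -/

/-- `φ_j` of a standard complex `C(a_1, …, a_n)`: the signed count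
`#{i odd : a_i = j} − #{i odd : a_i = −j}` (with 1-based odd `i`). -/
def phi (j : ℕ) (L : List ℤ) : ℤ :=
  ∑ i ∈ Finset.range L.length,
    if i % 2 = 0 then
      (if L.getD i 0 = (j : ℤ) then 1 else 0) - (if L.getD i 0 = -(j : ℤ) then 1 else 0)
    else 0

/-- The shift `sh_m` on parameter sequences: entries of absolute value `≥ m` are pushed
one further from zero; entries of absolute value `< m` are fixed. -/
def shSeq (m : ℕ) (L : List ℤ) : List ℤ :=
  L.map fun a => if (m : ℤ) ≤ a then a + 1 else if a ≤ -(m : ℤ) then a - 1 else a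

/-- `P(C) = -2 ∑_{j>0} j φ_j(C) + ∑_i sgn a_i`, computed from the parameter sequence of
the standard representative (the sum over `j` is finite since `φ_j` vanishes for
`j` larger than any `|a_i|`). -/
def Pval (L : List ℤ) : ℤ :=
  -2 * (∑ j ∈ Finset.range ((L.map Int.natAbs).sum + 1), (j : ℤ) * phi j L) +
    (L.map Int.sign).sum

end

noncomputable section

/-- The ring homomorphism `R → S` with `U ↦ a` and `V ↦ b`, where `a * b = 0`. -/
def evalUV {S : Type*} [CommRing S] [Algebra (ZMod 2) S] (a b : S) (hab : a * b = 0) :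
    RUV →+* S :=
  Ideal.Quotient.lift IUV (MvPolynomial.aeval ![a, b] : PolyUV →ₐ[ZMod 2] S).toRingHom (by
    intro r hr
    obtain ⟨s, rfl⟩ := Ideal.mem_span_singleton.mp hr
    simp [hab])

theorem evalUV_Uv {S : Type*} [CommRing S] [Algebra (ZMod 2) S] (a b : S) (hab : a * b = 0) :
    evalUV a b hab Uv = a := by
  simp [evalUV, Uv]

theorem evalUV_Vv {S : Type*} [CommRing S] [Algebra (ZMod 2) S] (a b : S) (hab : a * b = 0) :
    evalUV a b hab Vv = b := by
  simp [evalUV, Vv]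

/-- Reduction modulo `U`, as a map `R → 𝔽₂[V]`. -/
def modU : RUV →+* Polynomial (ZMod 2) := evalUV 0 Polynomial.X (zero_mul _)

/-- The specialization `U = 0`, `V = 1`. -/
def rhoV : RUV →+* ZMod 2 := evalUV 0 1 (zero_mul _)

/-- The specialization `U = 1`, `V = 0`. -/
def rhoU : RUV →+* ZMod 2 := evalUV 1 0 (mul_zero _)

@[simp] theorem modU_Uv : modU Uv = 0 := evalUV_Uv _ _ _
@[simp] theorem modU_Vv : modU Vv = Polynomial.X := evalUV_Vv _ _ _
@[simp] theorem rhoV_Uv : rhoV Uv = 0 := evalUV_Uv _ _ _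
@[simp] theorem rhoV_Vv : rhoV Vv = 1 := evalUV_Vv _ _ _
@[simp] theorem rhoU_Uv : rhoU Uv = 1 := evalUV_Uv _ _ _
@[simp] theorem rhoU_Vv : rhoU Vv = 0 := evalUV_Vv _ _ _

theorem Uv_mul_Vv : Uv * Vv = 0 := by
  rw [Uv, Vv, ← map_mul]
  exact Ideal.Quotient.eq_zero_iff_mem.mpr (Ideal.mem_span_singleton_self _)

theorem zmod_two_cases (a : ZMod 2) : a = 0 ∨ a = 1 := by
  revert a; decide

theorem RUV.add_self (r : RUV) : r + r = 0 := by
  have h : (2 : RUV) = 0 := by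
    have h2 : (2 : PolyUV) = 0 := by
      have := map_ofNat (MvPolynomial.C : ZMod 2 →+* PolyUV) 2
      rw [← this, show (OfNat.ofNat 2 : ZMod 2) = 0 from rfl, map_zero]
    have := map_ofNat (Ideal.Quotient.mk IUV) 2
    rw [← this]
    exact (congrArg _ h2).trans (map_zero _)
  rw [← two_mul, h, zero_mul]

/-! ### Homogeneous elements of `R` -/

theorem IsHomog.zero (p q : ℤ) : IsHomog 0 p q := Or.inl rfl

theorem IsHomog.one : IsHomog 1 0 0 := Or.inr (Or.inl ⟨0, by simp, by simp, rfl⟩)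

theorem IsHomog.Uv_pow (a : ℕ) : IsHomog (Uv ^ a) (-(2 * (a : ℤ))) 0 :=
  Or.inr (Or.inl ⟨a, rfl, rfl, rfl⟩)

theorem IsHomog.Vv_pow (b : ℕ) : IsHomog (Vv ^ b) 0 (-(2 * (b : ℤ))) :=
  Or.inr (Or.inr ⟨b, rfl, rfl, rfl⟩)

theorem IsHomog.add {r s : RUV} {p q : ℤ} (hr : IsHomog r p q) (hs : IsHomog s p q) :
    IsHomog (r + s) p q := by
  rcases hr with rfl | ⟨a, rfl, ha, ha'⟩ | ⟨a, rfl, ha, ha'⟩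
  · rwa [zero_add]
  · rcases hs with rfl | ⟨b, rfl, hb, hb'⟩ | ⟨b, rfl, hb, hb'⟩
    · rw [add_zero, ha, ha']; exact .Uv_pow a
    · obtain rfl : a = b := by omega
      rw [RUV.add_self]; exact .zero _ _
    · obtain rfl : a = 0 := by omega
      obtain rfl : b = 0 := by omega
      rw [pow_zero, pow_zero, RUV.add_self]; exact .zero _ _
  · rcases hs with rfl | ⟨b, rfl, hb, hb'⟩ | ⟨b, rfl, hb, hb'⟩
    · rw [add_zero, ha, ha']; exact .Vv_pow a
    · obtain rfl : a = 0 := by omega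
      obtain rfl : b = 0 := by omega
      rw [pow_zero, pow_zero, RUV.add_self]; exact .zero _ _
    · obtain rfl : a = b := by omega
      rw [RUV.add_self]; exact .zero _ _

theorem IsHomog.sub {r s : RUV} {p q : ℤ} (hr : IsHomog r p q) (hs : IsHomog s p q) :
    IsHomog (r - s) p q := by
  rw [show r - s = r + s by rw [sub_eq_iff_eq_add, add_assoc, RUV.add_self, add_zero]]
  exact hr.add hs

theorem IsHomog.sum {ι : Type*} {s : Finset ι} {r : ι → RUV} {p q : ℤ}
    (h : ∀ i ∈ s, IsHomog (r i) p q) : IsHomog (∑ i ∈ s, r i) p q :=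
  Finset.sum_induction r (fun x => IsHomog x p q) (fun _ _ => IsHomog.add) (.zero _ _) h

theorem Uv_pow_mul_Vv_pow (a b : ℕ) : Uv ^ (a + 1) * Vv ^ (b + 1) = 0 := by
  rw [pow_succ, pow_succ', mul_assoc, ← mul_assoc Uv, Uv_mul_Vv, zero_mul, mul_zero]

theorem IsHomog.Uv_pow_mul_Vv_pow (a b : ℕ) :
    IsHomog (Uv ^ a * Vv ^ b) (-(2 * (a : ℤ))) (-(2 * (b : ℤ))) := by
  rcases a with _ | a
  · simpa using IsHomog.Vv_pow b
  rcases b with _ | b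
  · simpa using IsHomog.Uv_pow (a + 1)
  · rw [_root_.Uv_pow_mul_Vv_pow]; exact .zero _ _

theorem IsHomog.mul {r s : RUV} {p q p' q' : ℤ} (hr : IsHomog r p q) (hs : IsHomog s p' q') :
    IsHomog (r * s) (p + p') (q + q') := by
  rcases hr with rfl | ⟨a, rfl, rfl, rfl⟩ | ⟨a, rfl, rfl, rfl⟩
  · rw [zero_mul]; exact .zero _ _
  · rcases hs with rfl | ⟨b, rfl, rfl, rfl⟩ | ⟨b, rfl, rfl, rfl⟩
    · rw [mul_zero]; exact .zero _ _
    · rw [← pow_add]; convert IsHomog.Uv_pow (a + b) using 1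
      · push_cast; ring
      · rfl
    · simpa using IsHomog.Uv_pow_mul_Vv_pow a b
  · rcases hs with rfl | ⟨b, rfl, rfl, rfl⟩ | ⟨b, rfl, rfl, rfl⟩
    · rw [mul_zero]; exact .zero _ _
    · rw [mul_comm]; simpa using IsHomog.Uv_pow_mul_Vv_pow b a
    · rw [← pow_add]; convert IsHomog.Vv_pow (a + b) using 1
      · rfl
      · push_cast; ring

theorem IsHomog.Uv_dvd {r : RUV} {p q : ℤ} (hr : IsHomog r p q) (h : rhoV r = 0) : Uv ∣ r := by
  rcases hr with rfl | ⟨a, rfl, -, -⟩ | ⟨b, rfl, -, -⟩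
  · exact dvd_zero _
  · rcases a with _ | a
    · simp at h
    · exact dvd_pow_self _ (Nat.succ_ne_zero a)
  · simp at h

theorem IsHomog.eq_zero {r : RUV} {p q : ℤ} (hr : IsHomog r p q) (hV : rhoV r = 0)
    (hU : rhoU r = 0) : r = 0 := by
  rcases hr with rfl | ⟨a, rfl, -, -⟩ | ⟨b, rfl, -, -⟩
  · rfl
  · simp at hU
  · simp at hV

theorem IsHomog.of_rhoV_ne_zero {r : RUV} {p q : ℤ} (hr : IsHomog r p q) (h : rhoV r ≠ 0) :
    p = 0 ∧ ∃ b : ℕ, q = -(2 * (b : ℤ)) := by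
  rcases hr with rfl | ⟨a, rfl, rfl, rfl⟩ | ⟨b, rfl, rfl, rfl⟩
  · simp at h
  · rcases a with _ | a
    · exact ⟨by simp, 0, by simp⟩
    · simp at h
  · exact ⟨rfl, b, rfl⟩

theorem IsHomog.of_rhoU_ne_zero {r : RUV} {p q : ℤ} (hr : IsHomog r p q) (h : rhoU r ≠ 0) :
    q = 0 ∧ ∃ a : ℕ, p = -(2 * (a : ℤ)) := by
  rcases hr with rfl | ⟨a, rfl, rfl, rfl⟩ | ⟨b, rfl, rfl, rfl⟩
  · simp at h
  · exact ⟨rfl, a, rfl⟩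
  · rcases b with _ | b
    · exact ⟨by simp, 0, by simp⟩
    · simp at h

/-- A homogeneous element is determined by its two specializations; this gives the
possible values. -/
theorem exists_isHomog (p q : ℤ) (u v : ZMod 2)
    (hu : u ≠ 0 → p = 0 ∧ ∃ b : ℕ, q = -(2 * (b : ℤ)))
    (hv : v ≠ 0 → q = 0 ∧ ∃ a : ℕ, p = -(2 * (a : ℤ)))
    (huv : p = 0 → q = 0 → u = v) :
    ∃ r, IsHomog r p q ∧ rhoV r = u ∧ rhoU r = v := by
  rcases zmod_two_cases u with rfl | rfl
  · rcases zmod_two_cases v with rfl | rfl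
    · exact ⟨0, .zero _ _, by simp, by simp⟩
    · obtain ⟨rfl, a, rfl⟩ := hv one_ne_zero
      refine ⟨Uv ^ a, .Uv_pow a, ?_, by simp⟩
      rcases a with _ | a
      · simp at huv
      · simp
  · obtain ⟨rfl, b, rfl⟩ := hu one_ne_zero
    refine ⟨Vv ^ b, .Vv_pow b, by simp, ?_⟩
    rcases b with _ | b
    · simpa using huv
    · have : v = 0 := by
        by_contra h
        have := (hv h).1
        omega
      simp [this]

theorem exists_isHomog_rhoV (p q : ℤ) (u : ZMod 2)
    (hu : u ≠ 0 → p = 0 ∧ ∃ b : ℕ, q = -(2 * (b : ℤ))) :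
    ∃ r, IsHomog r p q ∧ rhoV r = u := by
  obtain ⟨r, hr, h, -⟩ := exists_isHomog p q u (if p = 0 ∧ q = 0 then u else 0) hu
    (fun h => by
      split_ifs at h with h'
      · exact ⟨h'.2, 0, by simp [h'.1]⟩
      · exact absurd rfl h)
    (fun h h' => by simp [h, h'])
  exact ⟨r, hr, h⟩

/-- Homogeneous elements of pairwise distinct degrees are independent modulo `U`. -/
theorem Uv_dvd_of_dvd_sum {s : Finset (ℤ × ℤ)} {r : ℤ × ℤ → RUV} {c d : ℤ}
    (hr : ∀ t ∈ s, IsHomog (r t) (t.1 - c) (t.2 - d)) (hs : Uv ∣ ∑ t ∈ s, r t)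
    {t : ℤ × ℤ} (ht : t ∈ s) : Uv ∣ r t := by
  refine (hr t ht).Uv_dvd ?_
  by_contra hne
  have key : ∀ x : RUV, ∀ p q, IsHomog x p q → rhoV x ≠ 0 →
      ∃ b : ℕ, modU x = Polynomial.X ^ b ∧ p = 0 ∧ q = -(2 * (b : ℤ)) := by
    rintro x p q (rfl | ⟨a, rfl, rfl, rfl⟩ | ⟨b, rfl, rfl, rfl⟩) h
    · simp at h
    · rcases a with _ | a
      · exact ⟨0, by simp, by simp, by simp⟩
      · simp at h
    · exact ⟨b, by simp, rfl, rfl⟩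
  obtain ⟨b, hb, hb1, hb2⟩ := key _ _ _ (hr t ht) hne
  obtain ⟨y, hy⟩ := hs
  have h0 := congrArg (fun x => (modU x).coeff b) hy
  simp only [map_sum, map_mul, modU_Uv, zero_mul, Polynomial.coeff_zero,
    Polynomial.finsetSum_coeff] at h0
  rw [Finset.sum_eq_single_of_mem t ht, hb] at h0
  · simp at h0
  · intro t' ht' htt'
    by_cases h' : rhoV (r t') = 0
    · obtain ⟨z, hz⟩ := (hr t' ht').Uv_dvd h'
      simp [hz]
    · obtain ⟨b', hb', hb1', hb2'⟩ := key _ _ _ (hr t' ht') h'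
      rw [hb', Polynomial.coeff_X_pow, if_neg]
      rintro rfl
      exact htt' (Prod.ext (by omega) (by omega))

/-! ### Chains -/

theorem dmap_apply (C : PreCx) (x : Msub C) (j : Fin C.n) :
    dmap C x j = ∑ i, x i * C.dm i j := by
  rw [dmap, Finsupp.linearCombination_apply, Finsupp.sum_fintype _ _ (by simp),
    Finsupp.finsetSum_apply]
  refine Finset.sum_congr rfl fun i _ => ?_
  rw [Finsupp.smul_apply, Finsupp.finsetSum_apply, smul_eq_mul,
    Finset.sum_eq_single_of_mem j (Finset.mem_univ j)]
  · simp
  · intro k _ hk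
    exact Finsupp.single_eq_of_ne' hk

theorem mem_uSub_iff (C : PreCx) (x : Msub C) : x ∈ uSub C ↔ ∀ j, Uv ∣ x j := by
  constructor
  · rintro ⟨y, rfl⟩ j
    exact ⟨y j, rfl⟩
  · intro h
    choose y hy using h
    refine ⟨Finsupp.equivFunOnFinite.symm y, ?_⟩
    ext j
    exact (hy j).symm

namespace ChainHomog

variable {C : PreCx} {x y : Msub C} {p q : ℤ}

theorem zero (p q : ℤ) : ChainHomog C 0 p q := fun _ => .zero _ _

theorem add (hx : ChainHomog C x p q) (hy : ChainHomog C y p q) : ChainHomog C (x + y) p q :=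
  fun j => (hx j).add (hy j)

theorem sub (hx : ChainHomog C x p q) (hy : ChainHomog C y p q) : ChainHomog C (x - y) p q :=
  fun j => (hx j).sub (hy j)

theorem Vv_pow_smul (hx : ChainHomog C x p q) (k : ℕ) :
    ChainHomog C (Vv ^ k • x) p (q - 2 * k) := fun j => by
  change IsHomog (Vv ^ k * x j) _ _
  convert (IsHomog.Vv_pow k).mul (hx j) using 1 <;> ring

theorem dmap (hd : ∀ i j, IsHomog (C.dm i j)
      ((C.gr i).1 - 1 - (C.gr j).1) ((C.gr i).2 - 1 - (C.gr j).2))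
    (hx : ChainHomog C x p q) : ChainHomog C (dmap C x) (p - 1) (q - 1) := fun j => by
  rw [dmap_apply]
  refine IsHomog.sum fun i _ => ?_
  convert (hx i).mul (hd i j) using 1 <;> ring

theorem mem_uSub (hx : ChainHomog C x p q) (h : ∀ j, rhoV (x j) = 0) : x ∈ uSub C :=
  (mem_uSub_iff C x).mpr fun j => (hx j).Uv_dvd (h j)

theorem eq_zero (hx : ChainHomog C x p q) (hV : ∀ j, rhoV (x j) = 0) (hU : ∀ j, rhoU (x j) = 0) :
    x = 0 := by
  ext j
  exact (hx j).eq_zero (hV j) (hU j)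

end ChainHomog

theorem rhoV_eq_zero_of_dvd {r : RUV} (h : Uv ∣ r) : rhoV r = 0 := by
  obtain ⟨s, rfl⟩ := h
  simp

theorem rhoV_dmap (C : PreCx) (x : Msub C) (j : Fin C.n) :
    rhoV (dmap C x j) = ∑ i, rhoV (x i) * rhoV (C.dm i j) := by
  simp [dmap_apply]

theorem rhoU_dmap (C : PreCx) (x : Msub C) (j : Fin C.n) :
    rhoU (dmap C x j) = ∑ i, rhoU (x i) * rhoU (C.dm i j) := by
  simp [dmap_apply]

theorem exists_chainHomog_decomposition (C : PreCx) (x : Msub C) :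
    ∃ r : (ℤ × ℤ) →₀ Msub C,
      (∀ t, ChainHomog C (r t) t.1 t.2) ∧ r.sum (fun _ y => y) = x := by
  have add : ∀ x y : Msub C,
      (∃ r : (ℤ × ℤ) →₀ Msub C,
        (∀ t, ChainHomog C (r t) t.1 t.2) ∧ r.sum (fun _ y => y) = x) →
      (∃ r : (ℤ × ℤ) →₀ Msub C,
        (∀ t, ChainHomog C (r t) t.1 t.2) ∧ r.sum (fun _ y => y) = y) →
      ∃ r : (ℤ × ℤ) →₀ Msub C,
        (∀ t, ChainHomog C (r t) t.1 t.2) ∧ r.sum (fun _ y => y) = x + y := by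
    rintro x y ⟨r, hr, rfl⟩ ⟨s, hs, rfl⟩
    exact ⟨r + s, fun t => (hr t).add (hs t),
      Finsupp.sum_add_index' (fun _ => rfl) (fun _ _ _ => rfl)⟩
  have hom : ∀ (x : Msub C) (p q : ℤ), ChainHomog C x p q →
      ∃ r : (ℤ × ℤ) →₀ Msub C,
        (∀ t, ChainHomog C (r t) t.1 t.2) ∧ r.sum (fun _ y => y) = x := by
    intro x p q hx
    refine ⟨Finsupp.single (p, q) x, fun t => ?_, Finsupp.sum_single_index rfl⟩
    rw [Finsupp.single_apply]
    split_ifs with h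
    · rw [← h]; exact hx
    · exact .zero _ _
  induction x using Finsupp.induction_linear with
  | zero => exact hom 0 0 0 (.zero _ _)
  | add f g hf hg => exact add f g hf hg
  | single j r =>
    obtain ⟨P, rfl⟩ := Ideal.Quotient.mk_surjective r
    induction P using MvPolynomial.induction_on' with
    | add P Q hP hQ =>
      rw [map_add, Finsupp.single_add]
      exact add _ _ hP hQ
    | monomial s a =>
      rcases zmod_two_cases a with rfl | rfl
      · rw [MvPolynomial.monomial_zero, map_zero, Finsupp.single_zero]
        exact hom 0 0 0 (.zero _ _)
      · refine hom _ (-(2 * (s 0 : ℤ)) + (C.gr j).1) (-(2 * (s 1 : ℤ)) + (C.gr j).2) fun k => ?_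
        rw [Finsupp.single_apply]
        split_ifs with h
        · subst h
          have : Ideal.Quotient.mk IUV (MvPolynomial.monomial s 1) = Uv ^ s 0 * Vv ^ s 1 := by
            rw [MvPolynomial.monomial_eq, Finsupp.prod_fintype _ _ (by simp)]
            simp [Uv, Vv]
          rw [this, add_sub_cancel_right, add_sub_cancel_right]
          exact .Uv_pow_mul_Vv_pow _ _
        · exact .zero _ _

/-! ### Torsion modulo `U` -/

/-- The chains whose class modulo `U` becomes a boundary after multiplication by a power
of `V`. -/
def torsU (C : PreCx) : Submodule RUV (Msub C) where
  carrier := {x | ∃ k : ℕ, Vv ^ k • x ∈ bdryU C}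
  zero_mem' := ⟨0, by simp⟩
  add_mem' := by
    rintro x y ⟨k, hk⟩ ⟨l, hl⟩
    refine ⟨k + l, ?_⟩
    rw [smul_add]
    refine add_mem ?_ ?_
    · rw [add_comm, pow_add, mul_smul]; exact Submodule.smul_mem _ _ hk
    · rw [pow_add, mul_smul]; exact Submodule.smul_mem _ _ hl
  smul_mem' := by
    rintro r x ⟨k, hk⟩
    exact ⟨k, by rw [smul_comm]; exact Submodule.smul_mem _ _ hk⟩

theorem mem_torsU {C : PreCx} {x : Msub C} : x ∈ torsU C ↔ ∃ k : ℕ, Vv ^ k • x ∈ bdryU C :=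
  Iff.rfl

theorem mem_torsU_of_Vv_pow_smul {C : PreCx} {x : Msub C} {k : ℕ} (h : Vv ^ k • x ∈ torsU C) :
    x ∈ torsU C := by
  obtain ⟨l, hl⟩ := h
  exact ⟨l + k, by rwa [pow_add, mul_smul]⟩

theorem uSub_le_torsU (C : PreCx) : uSub C ≤ torsU C :=
  fun _ hx => ⟨0, by rw [pow_zero, one_smul]; exact Submodule.mem_sup_left hx⟩

theorem isVTowerGen_iff (C : PreCx) (x : Msub C) :
    IsVTowerGen C x ↔ dmap C x ∈ uSub C ∧ x ∉ torsU C ∧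
      ∀ z, dmap C z ∈ uSub C → ∃ r : RUV, z - r • x ∈ torsU C := by
  simp only [IsVTowerGen, mem_torsU, not_exists]

/-- If `x` generates the tower and is a multiple of a cycle `y` up to torsion, then `y`
generates the tower. -/
theorem IsVTowerGen.of_sub_smul_mem {C : PreCx} {x y : Msub C} (hx : IsVTowerGen C x)
    (hy : dmap C y ∈ uSub C) {r : RUV} (h : x - r • y ∈ torsU C) : IsVTowerGen C y := by
  rw [isVTowerGen_iff] at hx ⊢
  refine ⟨hy, fun h' => hx.2.1 ?_, fun z hz => ?_⟩
  · have := add_mem h (Submodule.smul_mem _ r h')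
    rwa [sub_add_cancel] at this
  · obtain ⟨s, hs⟩ := hx.2.2 z hz
    refine ⟨s * r, ?_⟩
    have := add_mem hs (Submodule.smul_mem _ s h)
    rwa [smul_sub, ← mul_smul, sub_add_sub_cancel] at this

/-- A matrix supported on pairs satisfying `P i ↔ Q j` carries combinations of rows
satisfying `P` to vectors supported on `Q`. -/
theorem exists_restricted_combination {ι κ : Type*} [Fintype ι] (M : ι → κ → ZMod 2)
    (P : ι → Prop) (Q : κ → Prop) (h : ∀ i j, M i j ≠ 0 → (P i ↔ Q j)) (α : ι → ZMod 2) :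
    ∃ α' : ι → ZMod 2, (∀ i, α' i ≠ 0 → P i) ∧
      (∀ j, ∑ i, α' i * M i j ≠ 0 → Q j) ∧
      ∀ j, Q j → ∑ i, α' i * M i j = ∑ i, α i * M i j := by
  classical
  refine ⟨fun i => if P i then α i else 0, fun i hi => ?_, fun j hj => ?_, fun j hj => ?_⟩
  · by_contra h'
    exact hi (if_neg h')
  · by_contra h'
    refine hj (Finset.sum_eq_zero fun i _ => ?_)
    by_cases hM : M i j = 0
    · rw [hM, mul_zero]
    · beta_reduce
      rw [if_neg (fun hP => h' ((h i j hM).mp hP)), zero_mul]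
  · refine Finset.sum_congr rfl fun i _ => ?_
    by_cases hM : M i j = 0
    · rw [hM, mul_zero, mul_zero]
    · beta_reduce
      rw [if_pos ((h i j hM).mpr hj)]

/-- The Fredholm alternative over `𝔽₂`. -/
theorem exists_functional_or_combination {ι κ : Type*} [Fintype ι] [Fintype κ]
    (A B : ι → κ → ZMod 2) (u : κ → ZMod 2) :
    (∃ φ : κ → ZMod 2, (∀ i, ∑ j, φ j * A i j = 0) ∧ (∀ i, ∑ j, φ j * B i j = 0) ∧
      ∑ j, φ j * u j = 1) ∨
    ∃ α β : ι → ZMod 2, ∀ j, u j = ∑ i, α i * A i j + ∑ i, β i * B i j := by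
  classical
  let T : (ι → ZMod 2) × (ι → ZMod 2) →ₗ[ZMod 2] (κ → ZMod 2) :=
    (Fintype.linearCombination (ZMod 2) A).coprod (Fintype.linearCombination (ZMod 2) B)
  by_cases hu : u ∈ LinearMap.range T
  · obtain ⟨⟨α, β⟩, rfl⟩ := hu
    refine Or.inr ⟨α, β, fun j => ?_⟩
    simp [T, Fintype.linearCombination_apply]
  · obtain ⟨f, hfu, hf⟩ := Submodule.exists_le_ker_of_notMem hu
    have hfx : ∀ v : κ → ZMod 2, ∑ j, f (Pi.single j 1) * v j = f v := by
      intro v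
      rw [LinearMap.pi_apply_eq_sum_univ f v]
      refine Finset.sum_congr rfl fun j _ => ?_
      rw [smul_eq_mul, mul_comm]
      congr 2
      ext k
      simp [Pi.single_apply, eq_comm]
    refine Or.inl ⟨fun j => f (Pi.single j 1), fun i => ?_, fun i => ?_, ?_⟩
    · rw [hfx]
      exact hf ⟨(Pi.single i 1, 0), by simp [T]⟩
    · rw [hfx]
      exact hf ⟨(0, Pi.single i 1), by simp [T]⟩
    · rw [hfx]
      exact (zmod_two_cases _).resolve_left hfu

/-! ### Homogeneous chains modulo `U` -/

theorem exists_chainHomog_rhoV (C : PreCx) (p q : ℤ) (u : Fin C.n → ZMod 2)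
    (hu : ∀ j, u j ≠ 0 → (C.gr j).1 = p ∧ ∃ b : ℕ, (C.gr j).2 = q + 2 * (b : ℤ)) :
    ∃ x, ChainHomog C x p q ∧ ∀ j, rhoV (x j) = u j := by
  choose r hr hr' using fun j => exists_isHomog_rhoV (p - (C.gr j).1) (q - (C.gr j).2) (u j)
    (fun h => by
      obtain ⟨h1, b, hb⟩ := hu j h
      exact ⟨by omega, b, by omega⟩)
  exact ⟨Finsupp.equivFunOnFinite.symm r, hr, hr'⟩

section KnotLike

variable {C : PreCx}

theorem IsKnotLike.gr_of_rhoV_dm_ne_zero (hC : IsKnotLike C) {i j : Fin C.n}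
    (h : rhoV (C.dm i j) ≠ 0) :
    (C.gr i).1 = (C.gr j).1 + 1 ∧ ∃ b : ℕ, (C.gr i).2 = (C.gr j).2 + 1 - 2 * (b : ℤ) := by
  obtain ⟨h1, b, hb⟩ := (hC.dhomog i j).of_rhoV_ne_zero h
  exact ⟨by omega, b, by omega⟩

theorem IsKnotLike.gr_of_rhoU_dm_ne_zero (hC : IsKnotLike C) {i j : Fin C.n}
    (h : rhoU (C.dm i j) ≠ 0) :
    (C.gr i).2 = (C.gr j).2 + 1 ∧ ∃ a : ℕ, (C.gr i).1 = (C.gr j).1 + 1 - 2 * (a : ℤ) := by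
  obtain ⟨h1, b, hb⟩ := (hC.dhomog i j).of_rhoU_ne_zero h
  exact ⟨by omega, b, by omega⟩

theorem ChainHomog.gr_of_rhoV_ne_zero {x : Msub C} {p q : ℤ} (hx : ChainHomog C x p q)
    {j : Fin C.n} (h : rhoV (x j) ≠ 0) :
    (C.gr j).1 = p ∧ ∃ b : ℕ, (C.gr j).2 = q + 2 * (b : ℤ) := by
  obtain ⟨h1, b, hb⟩ := (hx j).of_rhoV_ne_zero h
  exact ⟨by omega, b, by omega⟩

theorem IsKnotLike.dmap_dmap_single (hC : IsKnotLike C) (i j : Fin C.n) :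
    ∑ k, C.dm i k * C.dm k j = 0 := by
  have h := DFunLike.congr_fun (hC.dsq (Finsupp.single i 1)) j
  have h' : ∀ k, dmap C (Finsupp.single i 1) k = C.dm i k := by
    intro k
    rw [dmap_apply, Finset.sum_eq_single_of_mem i (Finset.mem_univ i)]
    · simp
    · intro l _ hl
      rw [Finsupp.single_eq_of_ne hl, zero_mul]
  rw [dmap_apply] at h
  simp only [h'] at h
  exact h

/-- Boundaries of the specialized complex are cycles. -/
theorem IsKnotLike.sum_sum_mul_eq_zero (hC : IsKnotLike C) (ρ : RUV →+* ZMod 2)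
    (α : Fin C.n → ZMod 2) (j : Fin C.n) :
    ∑ k, (∑ i, α i * ρ (C.dm i k)) * ρ (C.dm k j) = 0 := by
  simp_rw [Finset.sum_mul]
  rw [Finset.sum_comm]
  refine Finset.sum_eq_zero fun i _ => ?_
  simp_rw [mul_assoc]
  rw [← Finset.mul_sum]
  have := congrArg ρ (hC.dmap_dmap_single i j)
  rw [map_sum, map_zero] at this
  simp_rw [map_mul] at this
  rw [this, mul_zero]

theorem IsKnotLike.exists_restricted_rhoV (hC : IsKnotLike C) (p q : ℤ) (α : Fin C.n → ZMod 2) :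
    ∃ α' : Fin C.n → ZMod 2,
      (∀ i, α' i ≠ 0 → (C.gr i).1 = p + 1 ∧ ((C.gr i).2 - q - 1) % 2 = 0) ∧
      (∀ j, ∑ i, α' i * rhoV (C.dm i j) ≠ 0 → (C.gr j).1 = p ∧ ((C.gr j).2 - q) % 2 = 0) ∧
      ∀ j, (C.gr j).1 = p ∧ ((C.gr j).2 - q) % 2 = 0 →
        ∑ i, α' i * rhoV (C.dm i j) = ∑ i, α i * rhoV (C.dm i j) :=
  exists_restricted_combination (fun i j => rhoV (C.dm i j)) _ _
    (fun i j h => by obtain ⟨h1, b, hb⟩ := hC.gr_of_rhoV_dm_ne_zero h; omega) α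

theorem IsKnotLike.exists_restricted_rhoU (hC : IsKnotLike C) (p q : ℤ) (α : Fin C.n → ZMod 2) :
    ∃ α' : Fin C.n → ZMod 2,
      (∀ i, α' i ≠ 0 → (C.gr i).2 = q + 1 ∧ ((C.gr i).1 - p - 1) % 2 = 0) ∧
      (∀ j, ∑ i, α' i * rhoU (C.dm i j) ≠ 0 → (C.gr j).2 = q ∧ ((C.gr j).1 - p) % 2 = 0) ∧
      ∀ j, (C.gr j).2 = q ∧ ((C.gr j).1 - p) % 2 = 0 →
        ∑ i, α' i * rhoU (C.dm i j) = ∑ i, α i * rhoU (C.dm i j) :=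
  exists_restricted_combination (fun i j => rhoU (C.dm i j)) _ _
    (fun i j h => by obtain ⟨h1, b, hb⟩ := hC.gr_of_rhoU_dm_ne_zero h; omega) α

/-- A homogeneous chain which is a boundary after setting `V = 1` is `V`-torsion. -/
theorem IsKnotLike.mem_torsU_of_rhoV_eq (hC : IsKnotLike C) {x : Msub C} {p q : ℤ}
    (hx : ChainHomog C x p q) (α : Fin C.n → ZMod 2)
    (h : ∀ j, rhoV (x j) = ∑ i, α i * rhoV (C.dm i j)) : x ∈ torsU C := by
  obtain ⟨α', hα, hz, hα'⟩ := hC.exists_restricted_rhoV p q α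
  obtain ⟨K, hK⟩ : ∃ K : ℕ, ∀ i, ((C.gr i).2 - q - 1).natAbs ≤ K :=
    ⟨∑ i, ((C.gr i).2 - q - 1).natAbs, fun i =>
      Finset.single_le_sum (f := fun i => ((C.gr i).2 - q - 1).natAbs)
        (fun _ _ => Nat.zero_le _) (Finset.mem_univ i)⟩
  obtain ⟨w, hw, hw'⟩ := exists_chainHomog_rhoV C (p + 1) (q + 1 - 2 * K) α' (fun i hi => by
    obtain ⟨h1, h2⟩ := hα i hi
    have := hK i
    exact ⟨h1, (((C.gr i).2 - q - 1) / 2 + K).toNat, by omega⟩)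
  refine ⟨K, ?_⟩
  rw [← sub_add_cancel (Vv ^ K • x) (dmap C w)]
  refine add_mem (Submodule.mem_sup_left ?_) (Submodule.mem_sup_right ⟨w, rfl⟩)
  have hdw : ChainHomog C (dmap C w) p (q - 2 * K) := by
    convert hw.dmap hC.dhomog using 1 <;> ring
  refine ((hx.Vv_pow_smul K).sub hdw).mem_uSub fun j => ?_
  have hzj : rhoV (dmap C w j) = ∑ i, α' i * rhoV (C.dm i j) := by simp only [rhoV_dmap, hw']
  have hxj : rhoV ((Vv ^ K • x) j) = rhoV (x j) := by
    change rhoV (Vv ^ K * x j) = _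
    simp
  rw [Finsupp.sub_apply, map_sub, hxj, hzj, sub_eq_zero]
  by_cases hj : (C.gr j).1 = p ∧ ((C.gr j).2 - q) % 2 = 0
  · rw [h j, hα' j hj]
  · have h0 : rhoV (x j) = 0 := by
      by_contra hne
      obtain ⟨h1, b, hb⟩ := hx.gr_of_rhoV_ne_zero hne
      omega
    have h1 : ∑ i, α' i * rhoV (C.dm i j) = 0 := by
      by_contra hne
      exact hj (hz j hne)
    rw [h0, h1]

theorem IsKnotLike.exists_homogeneous_nontorsion (hC : IsKnotLike C) :
    ∃ q h, ChainHomog C h 0 q ∧ dmap C h ∈ uSub C ∧ h ∉ torsU C := by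
  obtain ⟨x, hx⟩ := hC.vTowerExists
  rw [isVTowerGen_iff] at hx
  obtain ⟨hx, hxt, -⟩ := hx
  obtain ⟨r, hr, hrx⟩ := exists_chainHomog_decomposition C x
  obtain ⟨t, ht, htt⟩ : ∃ t ∈ r.support, r t ∉ torsU C := by
    by_contra! hcon
    exact hxt (hrx ▸ Submodule.sum_mem _ hcon)
  have hcyc : dmap C (r t) ∈ uSub C := by
    rw [mem_uSub_iff] at hx ⊢
    intro j
    refine Uv_dvd_of_dvd_sum (s := r.support) (r := fun t => dmap C (r t) j)
      (c := 1 + (C.gr j).1) (d := 1 + (C.gr j).2) (fun t _ => ?_) ?_ ht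
    · convert (hr t).dmap hC.dhomog j using 1 <;> ring
    · have := hx j
      rwa [← hrx, Finsupp.sum, map_sum, Finsupp.finsetSum_apply] at this
  have hp := hC.vTowerGr _ _ _ (hr t) hcyc (not_exists.mp htt)
  exact ⟨t.2, r t, hp ▸ hr t, hcyc, htt⟩

theorem IsKnotLike.exists_maximal_nontorsion (hC : IsKnotLike C) :
    ∃ q h, ChainHomog C h 0 q ∧ dmap C h ∈ uSub C ∧ h ∉ torsU C ∧
      ∀ q' h', ChainHomog C h' 0 q' → dmap C h' ∈ uSub C → h' ∉ torsU C → q' ≤ q := by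
  obtain ⟨q, ⟨h, hh⟩, hmax⟩ := Int.exists_greatest_of_bdd
    (P := fun q => ∃ h, ChainHomog C h 0 q ∧ dmap C h ∈ uSub C ∧ h ∉ torsU C)
    ⟨∑ i, ((C.gr i).2.natAbs : ℤ), by
      rintro q ⟨h, hh, -, ht⟩
      obtain ⟨j, hj⟩ : ∃ j, rhoV (h j) ≠ 0 := by
        by_contra! hcon
        exact ht (uSub_le_torsU C (hh.mem_uSub hcon))
      obtain ⟨-, b, hb⟩ := hh.gr_of_rhoV_ne_zero hj
      have := Finset.single_le_sum (f := fun i => ((C.gr i).2.natAbs : ℤ))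
        (fun _ _ => Int.natCast_nonneg _) (Finset.mem_univ j)
      omega⟩
    hC.exists_homogeneous_nontorsion
  exact ⟨q, h, hh.1, hh.2.1, hh.2.2, fun q' h' h1 h2 h3 => hmax q' ⟨h', h1, h2, h3⟩⟩

/-! ### Homogeneous functionals -/

theorem IsHomog.eq_one {r : RUV} (hr : IsHomog r 0 0) (h : rhoV r = 1) : r = 1 := by
  rcases hr with rfl | ⟨a, rfl, ha, -⟩ | ⟨b, rfl, -, hb⟩
  · simp at h
  · obtain rfl : a = 0 := by omega
    simp
  · obtain rfl : b = 0 := by omega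
    simp

theorem linearCombination_eq_sum (C : PreCx) (m : Fin C.n → RUV) (x : Msub C) :
    Finsupp.linearCombination RUV m x = ∑ j, x j * m j := by
  rw [Finsupp.linearCombination_apply, Finsupp.sum_fintype _ _ (by simp)]
  rfl

theorem ChainHomog.linearCombination {x : Msub C} {p q s : ℤ} (hx : ChainHomog C x p q)
    {m : Fin C.n → RUV} (hm : ∀ j, IsHomog (m j) (C.gr j).1 ((C.gr j).2 - s)) :
    IsHomog (Finsupp.linearCombination RUV m x) p (q - s) := by
  rw [linearCombination_eq_sum]
  refine .sum fun j _ => ?_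
  convert (hx j).mul (hm j) using 1 <;> ring

theorem chainHomog_single (C : PreCx) (i : Fin C.n) :
    ChainHomog C (Finsupp.single i 1) (C.gr i).1 (C.gr i).2 := fun j => by
  rw [Finsupp.single_apply]
  split_ifs with h
  · rw [h, sub_self, sub_self]; exact .one
  · exact .zero _ _

theorem map_linearCombination_dmap_single (ρ : RUV →+* ZMod 2) (m : Fin C.n → RUV)
    (i : Fin C.n) :
    ρ (Finsupp.linearCombination RUV m (dmap C (Finsupp.single i 1))) =
      ∑ j, ρ (m j) * ρ (C.dm i j) := by
  rw [linearCombination_eq_sum, map_sum]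
  refine Finset.sum_congr rfl fun j _ => ?_
  rw [map_mul, mul_comm, dmap_apply, Finset.sum_eq_single_of_mem i (Finset.mem_univ i)]
  · simp
  · intro l _ hl
    rw [Finsupp.single_eq_of_ne hl, zero_mul]

/-- Functionals sending boundaries into `(U)` send `V`-torsion to `V`-torsion. -/
theorem exists_dvd_of_mem_torsU {F : Msub C →ₗ[RUV] RUV} (hF : ∀ x, Uv ∣ F (dmap C x))
    {z : Msub C} (hz : z ∈ torsU C) : ∃ k : ℕ, Uv ∣ Vv ^ k * F z := by
  obtain ⟨k, hk⟩ := hz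
  obtain ⟨_, ⟨y, rfl⟩, _, ⟨w, rfl⟩, hyw⟩ := Submodule.mem_sup.mp hk
  refine ⟨k, ?_⟩
  rw [← smul_eq_mul, ← map_smul, ← hyw, map_add]
  refine dvd_add ?_ (hF w)
  rw [LinearMap.lsmul_apply, map_smul]
  exact dvd_mul_right _ _

/-- A cycle on which some functional is `1` generates the tower. -/
theorem IsVTowerGen.of_functional {F : Msub C →ₗ[RUV] RUV} (hF : ∀ x, Uv ∣ F (dmap C x))
    {x h : Msub C} (hx : IsVTowerGen C x) (hh : dmap C h ∈ uSub C) (hFh : F h = 1) :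
    IsVTowerGen C h := by
  obtain ⟨r, hr⟩ := ((isVTowerGen_iff C x).mp hx).2.2 h hh
  obtain ⟨k, c, hk⟩ := exists_dvd_of_mem_torsU hF hr
  refine hx.of_sub_smul_mem hh (r := F x) (mem_torsU_of_Vv_pow_smul (k := k) ?_)
  rw [map_sub, map_smul, hFh, smul_eq_mul] at hk
  have e : Vv ^ k • (x - F x • h) = (Vv ^ k * (1 - r * F x)) • x - (Vv ^ k * F x) • (h - r • x) := by
    module
  rw [e, hk]
  refine sub_mem (uSub_le_torsU C ⟨c • x, ?_⟩) (Submodule.smul_mem _ _ hr)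
  rw [LinearMap.lsmul_apply, mul_smul]

open Classical in
theorem IsKnotLike.isVTowerGen_of_maximal (hC : IsKnotLike C) {q : ℤ} {h : Msub C}
    (hh : ChainHomog C h 0 q) (hcyc : dmap C h ∈ uSub C) (htor : h ∉ torsU C)
    (hmax : ∀ q' h', ChainHomog C h' 0 q' → dmap C h' ∈ uSub C → h' ∉ torsU C → q' ≤ q) :
    IsVTowerGen C h := by
  let J : Fin C.n → Prop := fun j => (C.gr j).1 = 0 ∧ ∃ b : ℕ, (C.gr j).2 = q - 2 * (b : ℤ)
  obtain ⟨φ, hφ, -, hφh⟩ | ⟨α, β, hu⟩ := exists_functional_or_combination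
    (fun i j => if J j then rhoV (C.dm i j) else 0) (fun (_ : Fin C.n) _ => 0)
    (fun j => if J j then rhoV (h j) else 0)
  · choose m hm hmV using fun j => exists_isHomog_rhoV (C.gr j).1 ((C.gr j).2 - q)
      (if J j then φ j else 0) (fun hj => by
        split_ifs at hj with h'
        · obtain ⟨h1, b, hb⟩ := h'
          exact ⟨h1, b, by omega⟩
        · exact absurd rfl hj)
    obtain ⟨x, hx⟩ := hC.vTowerExists
    have hF : ∀ x, Uv ∣ Finsupp.linearCombination RUV m (dmap C x) := by
      intro x
      induction x using Finsupp.induction_linear with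
      | zero => simp
      | add f g hf hg => rw [map_add, map_add]; exact dvd_add hf hg
      | single i r =>
        rw [← mul_one r, ← smul_eq_mul, ← Finsupp.smul_single, map_smul, map_smul, smul_eq_mul]
        refine Dvd.dvd.mul_left ?_ r
        refine (((chainHomog_single C i).dmap hC.dhomog).linearCombination hm).Uv_dvd ?_
        rw [map_linearCombination_dmap_single, ← hφ i]
        refine Finset.sum_congr rfl fun j _ => ?_
        rw [hmV]
        split_ifs <;> simp
    refine hx.of_functional hF hcyc (IsHomog.eq_one ?_ ?_)
    · simpa using hh.linearCombination hm
    · rw [linearCombination_eq_sum, map_sum, ← hφh]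
      refine Finset.sum_congr rfl fun j _ => ?_
      rw [map_mul, hmV, mul_comm]
      split_ifs <;> simp
  · exfalso
    obtain ⟨α', -, hz, hα'⟩ := hC.exists_restricted_rhoV 0 q α
    obtain ⟨y, hy, hyV⟩ := exists_chainHomog_rhoV C 0 (q + 2)
      (fun j => rhoV (h j) - ∑ i, α' i * rhoV (C.dm i j)) (fun j hj => by
        have hj' : (C.gr j).1 = 0 ∧ ((C.gr j).2 - q) % 2 = 0 := by
          by_cases h0 : rhoV (h j) = 0
          · exact hz j (fun h1 => hj (by rw [h0, h1, sub_zero]))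
          · obtain ⟨h1, b, hb⟩ := hh.gr_of_rhoV_ne_zero h0
            omega
        refine ⟨hj'.1, (((C.gr j).2 - q - 2) / 2).toNat, ?_⟩
        by_contra hne
        have hJj : J j := ⟨hj'.1, ((q - (C.gr j).2) / 2).toNat, by omega⟩
        have := hu j
        simp only [if_pos hJj, mul_zero, Finset.sum_const_zero, add_zero] at this
        exact hj (by rw [hα' j hj', this, sub_self]))
    have hyc : dmap C y ∈ uSub C := by
      refine (hy.dmap hC.dhomog).mem_uSub fun j => ?_
      rw [rhoV_dmap]
      simp only [hyV, sub_mul, Finset.sum_sub_distrib]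
      rw [hC.sum_sum_mul_eq_zero, ← rhoV_dmap,
        rhoV_eq_zero_of_dvd ((mem_uSub_iff C _).mp hcyc j), sub_zero]
    have hyt : y ∉ torsU C := by
      intro hyt
      have hhy : h - Vv ^ 1 • y ∈ torsU C := by
        refine hC.mem_torsU_of_rhoV_eq (p := 0) (q := q) (hh.sub ?_) α' fun j => ?_
        · simpa using hy.Vv_pow_smul 1
        · rw [Finsupp.sub_apply, map_sub, Finsupp.smul_apply, smul_eq_mul, map_mul, hyV]
          simp
      refine htor ?_
      rw [← sub_add_cancel h (Vv ^ 1 • y)]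
      exact add_mem hhy (Submodule.smul_mem _ _ hyt)
    have := hmax _ _ hy hyc hyt
    omega

/-- Either some homogeneous chain functional takes the value `1` on `h`, or `h` is, up to
`V`-torsion, represented by an honest cycle. -/
theorem IsKnotLike.exists_functional_or_cycle (hC : IsKnotLike C) {q : ℤ} {h : Msub C}
    (hh : ChainHomog C h 0 q) (hcyc : dmap C h ∈ uSub C) :
    (∃ m : Fin C.n → RUV, (∀ j, IsHomog (m j) (C.gr j).1 ((C.gr j).2 - q)) ∧
      (∀ x, Finsupp.linearCombination RUV m (dmap C x) = 0) ∧
      Finsupp.linearCombination RUV m h = 1) ∨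
    ∃ y, ChainHomog C y 0 q ∧ dmap C y = 0 ∧ h - y ∈ torsU C := by
  classical
  let J : Fin C.n → Prop := fun j => (C.gr j).1 = 0 ∧ ∃ b : ℕ, (C.gr j).2 = q - 2 * (b : ℤ)
  let L : Fin C.n → Prop := fun j => (C.gr j).2 = q ∧ ∃ a : ℕ, (C.gr j).1 = -(2 * (a : ℤ))
  obtain ⟨φ, hφ, hφ', hφh⟩ | ⟨α, β, hu⟩ := exists_functional_or_combination
    (fun i j => if J j then rhoV (C.dm i j) else 0)
    (fun i j => if L j then rhoU (C.dm i j) else 0)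
    (fun j => if J j then rhoV (h j) else 0)
  · left
    choose m hm hmV hmU using fun j => exists_isHomog (C.gr j).1 ((C.gr j).2 - q)
      (if J j then φ j else 0) (if L j then φ j else 0)
      (fun hj => by
        split_ifs at hj with h'
        · obtain ⟨h1, b, hb⟩ := h'
          exact ⟨h1, b, by omega⟩
        · exact absurd rfl hj)
      (fun hj => by
        split_ifs at hj with h'
        · obtain ⟨h1, a, ha⟩ := h'
          exact ⟨by omega, a, ha⟩
        · exact absurd rfl hj)
      (fun h1 h2 => by
        rw [if_pos ⟨h1, 0, by simp; omega⟩, if_pos ⟨by omega, 0, by simp [h1]⟩])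
    refine ⟨m, hm, fun x => ?_, IsHomog.eq_one ?_ ?_⟩
    · induction x using Finsupp.induction_linear with
      | zero => simp
      | add f g hf hg => rw [map_add, map_add, hf, hg, add_zero]
      | single i r =>
        rw [← mul_one r, ← smul_eq_mul, ← Finsupp.smul_single, map_smul, map_smul]
        rw [(((chainHomog_single C i).dmap hC.dhomog).linearCombination hm).eq_zero ?_ ?_,
          smul_zero]
        · rw [map_linearCombination_dmap_single, ← hφ i]
          refine Finset.sum_congr rfl fun j _ => ?_
          rw [hmV]
          split_ifs <;> simp
        · rw [map_linearCombination_dmap_single, ← hφ' i]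
          refine Finset.sum_congr rfl fun j _ => ?_
          rw [hmU]
          split_ifs <;> simp
    · simpa using hh.linearCombination hm
    · rw [linearCombination_eq_sum, map_sum, ← hφh]
      refine Finset.sum_congr rfl fun j _ => ?_
      rw [map_mul, hmV, mul_comm]
      split_ifs <;> simp
  · right
    obtain ⟨α', -, hz, hα'⟩ := hC.exists_restricted_rhoV 0 q α
    obtain ⟨β', -, hz', hβ'⟩ := hC.exists_restricted_rhoU 0 q β
    choose r hr hrV hrU using fun j => exists_isHomog (0 - (C.gr j).1) (q - (C.gr j).2)
      (rhoV (h j) - ∑ i, α' i * rhoV (C.dm i j)) (∑ i, β' i * rhoU (C.dm i j))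
      (fun hj => by
        have hj' : (C.gr j).1 = 0 ∧ ((C.gr j).2 - q) % 2 = 0 := by
          by_cases h0 : rhoV (h j) = 0
          · exact hz j (fun h1 => hj (by rw [h0, h1, sub_zero]))
          · obtain ⟨h1, b, hb⟩ := hh.gr_of_rhoV_ne_zero h0
            omega
        refine ⟨by omega, (((C.gr j).2 - q) / 2).toNat, ?_⟩
        by_contra hne
        have hJj : J j := ⟨hj'.1, ((q - (C.gr j).2) / 2).toNat, by omega⟩
        have hLj : ¬ L j := fun h' => by have := h'.1; omega
        have := hu j
        simp only [if_pos hJj, if_neg hLj, mul_zero, Finset.sum_const_zero, add_zero] at this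
        exact hj (by rw [hα' j hj', this, sub_self]))
      (fun hj => by
        have hj' := hz' j hj
        refine ⟨by omega, ((C.gr j).1 / 2).toNat, ?_⟩
        by_contra hne
        have hLj : L j := ⟨hj'.1, ((-(C.gr j).1) / 2).toNat, by omega⟩
        have hJj : ¬ J j := fun h' => by have := h'.1; omega
        have := hu j
        simp only [if_pos hLj, if_neg hJj, mul_zero, Finset.sum_const_zero, zero_add] at this
        exact hj (by rw [hβ' j hj', ← this]))
      (fun h1 h2 => by
        have hJj : J j := ⟨by omega, 0, by simp; omega⟩
        have hLj : L j := ⟨by omega, 0, by simp; omega⟩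
        have := hu j
        simp only [if_pos hJj, if_pos hLj] at this
        rw [this, hα' j (by omega), hβ' j (by omega), add_sub_cancel_left])
    have hy : ChainHomog C (Finsupp.equivFunOnFinite.symm r) 0 q := hr
    refine ⟨Finsupp.equivFunOnFinite.symm r, hy, (hy.dmap hC.dhomog).eq_zero (fun j => ?_)
      (fun j => ?_), hC.mem_torsU_of_rhoV_eq (hh.sub hy) α' fun j => ?_⟩
    · rw [rhoV_dmap]
      simp only [Finsupp.equivFunOnFinite_symm_apply_apply, hrV, sub_mul, Finset.sum_sub_distrib]
      rw [hC.sum_sum_mul_eq_zero, ← rhoV_dmap,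
        rhoV_eq_zero_of_dvd ((mem_uSub_iff C _).mp hcyc j), sub_zero]
    · rw [rhoU_dmap]
      simp only [Finsupp.equivFunOnFinite_symm_apply_apply, hrU]
      exact hC.sum_sum_mul_eq_zero _ _ _
    · rw [Finsupp.sub_apply, map_sub, Finsupp.equivFunOnFinite_symm_apply_apply, hrV,
        sub_sub_cancel]

/-! ### The trivial complex -/

theorem dmap_trivCx (x : Msub trivCx) : dmap trivCx x = 0 := by
  have h : ∀ i j, trivCx.dm i j = 0 := fun i j => by simp [trivCx, StdCx, stdDm]
  ext j
  simp [dmap_apply, h]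

/-- The unique basis index of the trivial complex. -/
def trivIdx : Fin trivCx.n := (0 : Fin 1)

theorem eq_trivIdx (i : Fin trivCx.n) : i = trivIdx :=
  Subsingleton.elim (α := Fin 1) _ _

theorem gr_trivCx (i : Fin trivCx.n) : trivCx.gr i = (0, 0) := by
  rw [eq_trivIdx i]
  simp [trivIdx, trivCx, StdCx, stdGr, grRel]

/-- The basis vector of the trivial complex. -/
def trivOne : Msub trivCx := Finsupp.single trivIdx 1

theorem trivOne_apply (i : Fin trivCx.n) : trivOne i = 1 := by
  rw [eq_trivIdx i]
  exact Finsupp.single_eq_same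

theorem eq_smul_trivOne (x : Msub trivCx) : x = x trivIdx • trivOne := by
  ext j
  rw [Finsupp.smul_apply, trivOne_apply, smul_eq_mul, mul_one, eq_trivIdx j]

theorem smul_trivOne_mem_uSub {r : RUV} (h : Uv ∣ r) : r • trivOne ∈ uSub trivCx := by
  obtain ⟨s, rfl⟩ := h
  exact ⟨s • trivOne, by rw [LinearMap.lsmul_apply, mul_smul]⟩

theorem isVTowerGen_trivOne : IsVTowerGen trivCx trivOne := by
  rw [isVTowerGen_iff]
  refine ⟨by rw [dmap_trivCx]; exact zero_mem _, ?_, fun z _ => ⟨z trivIdx, ?_⟩⟩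
  · rintro ⟨k, hk⟩
    obtain ⟨y, hy, _, ⟨w, rfl⟩, hyw⟩ := Submodule.mem_sup.mp hk
    rw [dmap_trivCx, add_zero] at hyw
    rw [hyw] at hy
    have h0 := (mem_uSub_iff _ _).mp hy trivIdx
    have := rhoV_eq_zero_of_dvd h0
    rw [Finsupp.smul_apply, trivOne_apply, smul_eq_mul, mul_one] at this
    simp at this
  · rw [← eq_smul_trivOne, sub_self]
    exact zero_mem _

theorem localLE_trivCx_of_cycle {y : Msub C} {q : ℤ} (hy : ChainHomog C y 0 q)
    (hdy : dmap C y = 0) (hgen : IsVTowerGen C y) : LocalLE trivCx C := by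
  let f : Msub trivCx →ₗ[RUV] Msub C := Finsupp.linearCombination RUV fun _ => y
  have hf1 : f trivOne = y := by
    rw [trivOne, Finsupp.linearCombination_single, one_smul]
  have hf : ∀ x, f x = x trivIdx • y := fun x => by
    rw [← hf1, ← map_smul, ← eq_smul_trivOne]
  have hdf : ∀ x, dmap C (f x) = 0 := fun x => by rw [hf, map_smul, hdy, smul_zero]
  refine ⟨f, fun x => by rw [dmap_trivCx, map_zero, hdf], ⟨q, fun i j => ?_⟩, fun x hx => ?_⟩
  · rw [gr_trivCx, Finsupp.linearCombination_single, one_smul]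
    simpa using hy j
  · obtain ⟨r, k, hr⟩ := hx.2.2 trivOne (by rw [dmap_trivCx]; exact zero_mem _)
    refine hgen.of_sub_smul_mem (by rw [hdf]; exact zero_mem _) (r := r) ⟨k, ?_⟩
    rw [← hf1, ← map_smul, ← map_sub, ← map_smul]
    obtain ⟨_, ⟨z, rfl⟩, _, ⟨w, rfl⟩, hzw⟩ := Submodule.mem_sup.mp hr
    rw [← hzw, dmap_trivCx, add_zero, LinearMap.lsmul_apply, map_smul]
    exact Submodule.mem_sup_left ⟨f z, rfl⟩

theorem localLE_trivCx_of_functional {m : Fin C.n → RUV} {q : ℤ} {h : Msub C}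
    (hm : ∀ j, IsHomog (m j) (C.gr j).1 ((C.gr j).2 - q))
    (hmd : ∀ x, Finsupp.linearCombination RUV m (dmap C x) = 0)
    (hh : dmap C h ∈ uSub C) (hmh : Finsupp.linearCombination RUV m h = 1) :
    LocalLE C trivCx := by
  refine ⟨(LinearMap.toSpanSingleton RUV _ trivOne).comp (Finsupp.linearCombination RUV m),
    fun x => ?_, ⟨-q, fun i j => ?_⟩, fun x hx => ?_⟩
  · rw [dmap_trivCx, LinearMap.comp_apply, hmd, map_zero]
  · rw [gr_trivCx, LinearMap.comp_apply, LinearMap.toSpanSingleton_apply, Finsupp.smul_apply,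
      trivOne_apply, Finsupp.linearCombination_single]
    simpa [sub_eq_add_neg] using hm i
  · obtain ⟨r, hr⟩ := ((isVTowerGen_iff C x).mp hx).2.2 h hh
    obtain ⟨k, hk⟩ := exists_dvd_of_mem_torsU (fun x => by rw [hmd]; exact dvd_zero _) hr
    refine isVTowerGen_trivOne.of_sub_smul_mem (by rw [dmap_trivCx]; exact zero_mem _) (r := r)
      (mem_torsU_of_Vv_pow_smul (k := k) (uSub_le_torsU _ ?_))
    rw [map_sub, map_smul, hmh, smul_eq_mul] at hk
    convert smul_trivOne_mem_uSub hk using 1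
    rw [LinearMap.comp_apply, LinearMap.toSpanSingleton_apply]
    module

end KnotLike

end

/-- Let `C` be a knot-like complex.  If there does not exist a local
map from `R` (the trivial knot-like complex, concentrated in bigrading `(0,0)` with
zero differential) to `C`, then there exists a local map from `C` to `R`. -/
theorem local_map_to_trivial_of_not_from_trivial (C : PreCx) (hC : IsKnotLike C)
    (h : ¬ LocalLE trivCx C) : LocalLE C trivCx := by
  obtain ⟨q, x, hx, hcyc, htor, hmax⟩ := hC.exists_maximal_nontorsion
  obtain ⟨m, hm, hmd, hmx⟩ | ⟨y, hy, hdy, hxy⟩ := hC.exists_functional_or_cycle hx hcyc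
  · exact localLE_trivCx_of_functional hm hmd hcyc hmx
  · refine absurd (localLE_trivCx_of_cycle hy hdy ?_) h
    refine (hC.isVTowerGen_of_maximal hx hcyc htor hmax).of_sub_smul_mem (r := 1) ?_ ?_
    · rw [hdy]; exact zero_mem _
    · rwa [one_smul]
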